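/- Let Ω ⊆ ℝ^d, let Θ be a nonsingular d×d real matrix, let σ² > 0, and let Φ: ℝ^d → ℝ be a continuous, integrable, even function whose Fourier transform Φ̂ (with convention Φ̂(ω) = (2π)^{-d/2}∫ Φ(x)e^{-iω'x}dx) is nonnegative, belongs to L¹(ℝ^d), and satisfies the inversion formula Φ(x) = (2π)^{-d/2}∫ Φ̂(ω)e^{iω'x}dω. Let x₁,…,xₙ ∈ Ω be points such that the transformed points Θx₁,…,Θxₙ are pairwise distinct, define q_j(Θ) = (1/2)·min_{k≠j} ‖Θ(x_j − x_k)‖₂ and q(Θ) = min_j q_j(Θ), let c* > 0, and let Ψ(u,v) = σ²Φ(Θ(u − v)). Then the smallest eigenvalue of the kernel matrix Ψ(X,X) = {Ψ(x_i,x_j)} satisfies λ_min(Ψ(X,X)) ≥ σ² · min_{i} ℓ_i(Θ), where ℓ_i(Θ) = Υ₀(c*/q(Θ))·(1 − (Γ(d/2+1)²π/18)·(q(Θ)/q_i(Θ))·(12/c*)^{d+1}), Υ₀(M) = (Φ̂_*(M)/Γ(d/2+1))·(M/2^{3/2})^d, and Φ̂_*(M) = inf_{‖ω‖₂ ≤ 2M}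 Φ̂(ω). -/

import Mathlib

open Matrix MeasureTheory Real

/-- The Euclidean norm of a vector in `ℝ^d`. -/
noncomputable def euclNorm {d : ℕ} (v : Fin d → ℝ) : ℝ :=
  Real.sqrt (∑ i, v i ^ 2)

/-- Half the distance from `Y j` to its nearest neighbour among the other points. -/
noncomputable def sepj {d n : ℕ} (Y : Fin n → (Fin d → ℝ)) (j : Fin n) : ℝ :=
  (1 / 2) * sInf {r : ℝ | ∃ k, k ≠ j ∧ r = euclNorm (Y j - Y k)}

/-- The separation distance of the point set `Y`. -/
noncomputable def sep {d n : ℕ} (Y : Fin n → (Fin d → ℝ)) : ℝ :=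
  ⨅ j, sepj Y j

/-- `Φ̂_*(M) = inf_{‖ω‖₂ ≤ 2M} Φ̂(ω)`. -/
noncomputable def fourierInf {d : ℕ} (Φhat : (Fin d → ℝ) → ℝ) (M : ℝ) : ℝ :=
  sInf (Φhat '' {ω | euclNorm ω ≤ 2 * M})

/-- `Υ₀(M) = (Φ̂_*(M)/Γ(d/2+1))·(M/2^{3/2})^d`. -/
noncomputable def Upsilon0 {d : ℕ} (Φhat : (Fin d → ℝ) → ℝ) (M : ℝ) : ℝ :=
  (fourierInf Φhat M / Real.Gamma ((d : ℝ) / 2 + 1)) * (M / 2 ^ ((3 : ℝ) / 2)) ^ d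

/-- The smallest eigenvalue of a symmetric matrix, characterized as the infimum of its
Rayleigh quotient over Euclidean unit vectors. -/
noncomputable def lamMin {n : ℕ} (A : Matrix (Fin n) (Fin n) ℝ) : ℝ :=
  sInf {r : ℝ | ∃ a : Fin n → ℝ, (∑ i, a i ^ 2) = 1 ∧ r = a ⬝ᵥ (A *ᵥ a)}

theorem four_mul_pow_le_Gamma_sq (d : ℕ) (hd : 1 ≤ d) :
    4 * ((d : ℝ) / (2 * exp 1)) ^ d ≤ Real.Gamma ((d : ℝ) / 2 + 1) ^ 2 := by
  have he := exp_one_gt_d9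
  induction d using Nat.strong_induction_on with
  | _ d ih =>
    rcases d with _ | _ | _ | d
    · omega
    · have h : Real.Gamma (((0 + 1 : ℕ) : ℝ) / 2 + 1) = 1 / 2 * √π := by
        rw [Real.Gamma_add_one (by norm_num)]; norm_num [Real.Gamma_one_half_eq]
      rw [h, mul_pow, Real.sq_sqrt pi_pos.le]
      have := pi_gt_d2
      simp only [Nat.zero_add, Nat.cast_one, pow_one]
      rw [mul_div_assoc', div_le_iff₀ (by positivity)]
      nlinarith
    · have h : (((0 + 1 + 1 : ℕ) : ℝ) / 2 + 1) = 2 := by norm_num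
      rw [h, Real.Gamma_two]
      push_cast
      rw [div_pow, mul_div_assoc', div_le_iff₀ (by positivity)]
      nlinarith
    · have h := ih (d + 1) (by omega) (by omega)
      have hx : (0 : ℝ) < ((d + 1 : ℕ) : ℝ) := by positivity
      have e : (((d + 1 + 1 + 1 : ℕ) : ℝ)) = ((d + 1 : ℕ) : ℝ) + 2 := by push_cast; ring
      have hg : Real.Gamma (((d + 1 + 1 + 1 : ℕ) : ℝ) / 2 + 1) =
          (((d + 1 : ℕ) : ℝ) / 2 + 1) * Real.Gamma (((d + 1 : ℕ) : ℝ) / 2 + 1) := by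
        rw [← Real.Gamma_add_one (by positivity), e]; congr 1; ring
      rw [hg, mul_pow, e]
      set m := d + 1
      set x : ℝ := (m : ℝ)
      have hb : (x + 2) ^ m ≤ x ^ m * exp 1 ^ 2 := by
        have h1 : (1 + 2 / x) ^ m ≤ exp (2 / x) ^ m := by
          gcongr
          linarith [add_one_le_exp (2 / x)]
        rw [← exp_nat_mul, show (m : ℝ) * (2 / x) = (2 : ℕ) * 1 by
          simp only [x] at hx ⊢; field_simp; norm_num, exp_nat_mul] at h1
        calc (x + 2) ^ m = x ^ m * (1 + 2 / x) ^ m := by rw [← mul_pow]; congr 1; field_simp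
          _ ≤ _ := by gcongr
      calc 4 * ((x + 2) / (2 * exp 1)) ^ (m + 2)
          = (x / 2 + 1) ^ 2 * (4 * ((x + 2) ^ m / exp 1 ^ 2 / (2 * exp 1) ^ m)) := by
            rw [pow_add, div_pow, div_pow]; field_simp
        _ ≤ (x / 2 + 1) ^ 2 * (4 * (x ^ m / (2 * exp 1) ^ m)) := by
            gcongr
            rw [div_le_iff₀ (by positivity)]; exact hb
        _ = (x / 2 + 1) ^ 2 * (4 * (x / (2 * exp 1)) ^ m) := by rw [div_pow]
        _ ≤ _ := by gcongr

section ScalarBounds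

variable {d : ℕ} {c : ℝ}

theorem five_thirds_mul_le_of_Gamma_sq_lt (hd : 1 ≤ d) (hc : 0 < c)
    (h : Real.Gamma ((d : ℝ) / 2 + 1) ^ 2 * π / 18 * (12 / c) ^ (d + 1) < 1) :
    5 / 3 * (d : ℝ) ≤ c ∧ 3 ≤ c := by
  have hG := four_mul_pow_le_Gamma_sq d hd
  have he := exp_one_gt_d9
  have he' := exp_one_lt_d9
  have hpi := pi_gt_d2
  have hd' : (1 : ℝ) ≤ d := by exact_mod_cast hd
  have key : ((d : ℝ) / (2 * exp 1)) ^ d * (2 * π / 9) < (c / 12) ^ (d + 1) := by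
    rw [show (12 / c) = (c / 12)⁻¹ by rw [inv_div], inv_pow, ← div_eq_mul_inv,
      div_lt_one (by positivity)] at h
    refine lt_of_le_of_lt ?_ h
    nlinarith
  have h1 : 5 / 3 * (d : ℝ) ≤ c := by
    by_contra! hcd
    have h2 : (c / 12) ^ (d + 1) ≤ (5 / 36 * (d : ℝ)) ^ (d + 1) := by
      gcongr; linarith
    have h3 : (5 / 36 * (d : ℝ)) ^ (d + 1) =
        ((d : ℝ) / (2 * exp 1)) ^ d * ((5 * exp 1 / 18) ^ d * (5 / 36 * d)) := by
      rw [pow_succ, ← mul_assoc (_ ^ d) (_ ^ d), ← mul_pow]; congr 2; field_simp; norm_num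
    have h4 : 2 * π / 9 < (5 * exp 1 / 18) ^ d * (5 / 36 * d) := by
      have := key.trans_le (h2.trans_eq h3)
      exact lt_of_mul_lt_mul_left this (by positivity)
    have h5 : 1 + (d : ℝ) * (3 / 10) ≤ (18 / (5 * exp 1)) ^ d := by
      refine (one_add_mul_le_pow (by norm_num) d).trans ?_
      gcongr
      rw [le_div_iff₀ (by positivity)]; linarith
    have h6 : (2 * π / 9) * (18 / (5 * exp 1)) ^ d < 5 / 36 * d := by
      calc _ < ((5 * exp 1 / 18) ^ d * (5 / 36 * d)) * (18 / (5 * exp 1)) ^ d := by gcongr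
        _ = ((5 * exp 1 / 18) * (18 / (5 * exp 1))) ^ d * (5 / 36 * d) := by rw [mul_pow]; ring
        _ = _ := by
          rw [show (5 * exp 1 / 18) * (18 / (5 * exp 1)) = 1 by field_simp]; simp
    nlinarith
  refine ⟨h1, ?_⟩
  rcases hd.eq_or_lt with rfl | h2
  · norm_num at key
    by_contra! h3
    have : (exp 1)⁻¹ ≥ 9 / 25 := by
      rw [ge_iff_le, le_inv_comm₀ (by norm_num) (by positivity)]; norm_num; linarith
    nlinarith
  · have : (2 : ℝ) ≤ d := by exact_mod_cast h2
    linarith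

theorem packing_tail_le (hd : 1 ≤ d) (hc : 0 < c)
    (h : Real.Gamma ((d : ℝ) / 2 + 1) ^ 2 * π / 18 * (12 / c) ^ (d + 1) < 1) :
    (Real.Gamma ((d : ℝ) / 2 + 1) * (√8 / (c / √d)) ^ d * exp (-(3 / 4 * (c / √d) ^ 2))) ≤
      1 / 25 := by
  obtain ⟨h1, h3⟩ := five_thirds_mul_le_of_Gamma_sq_lt hd hc h
  have hd' : (1 : ℝ) ≤ d := by exact_mod_cast hd
  have hpi := pi_gt_d2
  have hd0 : (0 : ℝ) < d := by linarith
  have hΓ : Real.Gamma ((d : ℝ) / 2 + 1) ^ 2 ≤ (c / 12) ^ (d + 1) * (18 / π) := by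
    rw [show (12 / c) = (c / 12)⁻¹ by rw [inv_div], inv_pow, ← div_eq_mul_inv,
      div_lt_one (by positivity)] at h
    rw [mul_div_assoc', le_div_iff₀ pi_pos]
    linarith
  have hexp : exp (-(3 / 4 * (c / √d) ^ 2)) ^ 2 ≤ exp (1 - c) * exp (-5) := by
    rw [← exp_nat_mul, ← exp_add, exp_le_exp, div_pow, Real.sq_sqrt hd0.le]
    have : 5 / 3 * c ≤ c ^ 2 / d := by
      rw [le_div_iff₀ hd0]; nlinarith
    push_cast
    linarith
  have hc1 : c * exp (1 - c) ≤ 1 := by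
    rw [show 1 - c = -(c - 1) by ring, exp_neg, ← div_eq_mul_inv, div_le_one (exp_pos _)]
    linarith [add_one_le_exp (c - 1)]
  have he5 : exp (-5) ≤ 1 / 140 := by
    rw [exp_neg, inv_le_comm₀ (exp_pos _) (by norm_num), show (5 : ℝ) = (5 : ℕ) * 1 by norm_num,
      exp_nat_mul]
    calc ((1 / 140)⁻¹ : ℝ) ≤ 2.71 ^ 5 := by norm_num
      _ ≤ _ := by gcongr; linarith [exp_one_gt_d9]
  have hpow : (c / 12) ^ (d + 1) * (18 / π) * (8 * d / c ^ 2) ^ d =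
      3 / (2 * π) * c * (2 * d / (3 * c)) ^ d := by
    calc _ = (c / 12 * (8 * d / c ^ 2)) ^ d * (c / 12 * (18 / π)) := by
          rw [mul_pow]; ring
      _ = (2 * d / (3 * c)) ^ d * (c / 12 * (18 / π)) := by
          congr 2; field_simp; norm_num
      _ = _ := by ring
  have hratio : (2 * d / (3 * c)) ^ d ≤ 2 / 5 := by
    have h5 : 2 * d / (3 * c) ≤ 2 / 5 := by
      rw [div_le_iff₀ (by positivity)]; linarith
    exact (pow_le_of_le_one (by positivity) (h5.trans (by norm_num)) (by omega)).trans h5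
  have hsq : (√8 / (c / √d)) ^ 2 = 8 * d / c ^ 2 := by
    rw [div_pow, div_pow, Real.sq_sqrt hd0.le, Real.sq_sqrt (by norm_num)]; field_simp
  refine le_of_abs_le (abs_le_of_sq_le_sq ?_ (by norm_num))
  calc _ = Real.Gamma ((d : ℝ) / 2 + 1) ^ 2 * (8 * d / c ^ 2) ^ d *
        exp (-(3 / 4 * (c / √d) ^ 2)) ^ 2 := by
        rw [mul_pow, mul_pow, ← pow_mul, mul_comm d 2, pow_mul, hsq]
    _ ≤ (c / 12) ^ (d + 1) * (18 / π) * (8 * d / c ^ 2) ^ d * (exp (1 - c) * exp (-5)) := by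
        gcongr
    _ = 3 / (2 * π) * (c * exp (1 - c)) * (2 * d / (3 * c)) ^ d * exp (-5) := by
        rw [hpow]; ring
    _ ≤ 3 / (2 * 3.14) * 1 * (2 / 5) * (1 / 140) := by gcongr
    _ ≤ _ := by norm_num

theorem volume_ratio_le (hd : 1 ≤ d) :
    √((d : ℝ) / 8) ^ d / Real.Gamma ((d : ℝ) / 2 + 1) ≤ 413 / 1000 := by
  have hG := four_mul_pow_le_Gamma_sq d hd
  have hd' : (1 : ℝ) ≤ d := by exact_mod_cast hd
  have he' := exp_one_lt_d9
  have hΓ : 0 < Real.Gamma ((d : ℝ) / 2 + 1) := Real.Gamma_pos_of_pos (by positivity)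
  have hR : ((d : ℝ) / 8) ^ d ≤ exp 1 / 16 * Real.Gamma ((d : ℝ) / 2 + 1) ^ 2 := by
    have h1 : (exp 1 / 4) ^ d ≤ exp 1 / 4 :=
      pow_le_of_le_one (by positivity) (by linarith) (by omega)
    calc ((d : ℝ) / 8) ^ d = (exp 1 / 4) ^ d * ((d : ℝ) / (2 * exp 1)) ^ d := by
          rw [← mul_pow]; congr 1; field_simp; norm_num
      _ ≤ exp 1 / 4 * ((d : ℝ) / (2 * exp 1)) ^ d := by gcongr
      _ = exp 1 / 16 * (4 * ((d : ℝ) / (2 * exp 1)) ^ d) := by ring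
      _ ≤ _ := by gcongr
  refine le_of_abs_le (abs_le_of_sq_le_sq ?_ (by norm_num))
  rw [div_pow, ← pow_mul, mul_comm d 2, pow_mul, Real.sq_sqrt (by positivity),
    div_le_iff₀ (by positivity)]
  refine hR.trans ?_
  gcongr
  linarith

theorem sqrt_two_div_exp_pow_le (hd : 1 ≤ d) : √2 ^ d * exp (-(d : ℝ)) ≤ 521 / 1000 := by
  have he := exp_one_gt_d9
  have h2 : √2 ≤ 1.4143 := Real.sqrt_le_iff.mpr ⟨by norm_num, by norm_num⟩
  have h : √2 * exp (-1) ≤ 521 / 1000 := by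
    rw [exp_neg, ← div_eq_mul_inv, div_le_iff₀ (exp_pos _)]
    linarith
  rw [show -(d : ℝ) = (d : ℕ) * (-1) by ring, exp_nat_mul, ← mul_pow]
  exact (pow_le_of_le_one (by positivity) (h.trans (by norm_num)) (by omega)).trans h
end ScalarBounds

theorem sum_exp_neg_mul_sq_norm_le {d : ℕ} (hd : 1 ≤ d) {ι : Type*} (s : Finset ι)
    (y : ι → EuclideanSpace ℝ (Fin d)) {q t : ℝ} (hq : 0 < q) (ht : 0 < t)
    (hy : ∀ i ∈ s, ∀ j ∈ s, i ≠ j → 2 * q ≤ dist (y i) (y j)) :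
    ∑ k ∈ s, exp (-(2 * t) * ‖y k‖ ^ 2) ≤
      exp (2 * t * q ^ 2) * (Real.Gamma ((d : ℝ) / 2 + 1) / (√t * q) ^ d) := by
  have : NeZero d := ⟨by omega⟩
  have hΓ : 0 < Real.Gamma ((d : ℝ) / 2 + 1) := Real.Gamma_pos_of_pos (by positivity)
  have hint : Integrable fun z : EuclideanSpace ℝ (Fin d) => exp (-t * ‖z‖ ^ 2) := by
    have h := (GaussianFourier.integrable_cexp_neg_mul_sq_norm_add (b := (t : ℂ)) (by simpa using ht)
      0 (0 : EuclideanSpace ℝ (Fin d))).re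
    refine h.congr (ae_of_all _ fun z => ?_)
    simp only [zero_mul, add_zero]
    rw [show (-(t : ℂ) * (‖z‖ : ℂ) ^ 2) = ((-t * ‖z‖ ^ 2 : ℝ) : ℂ) by push_cast; ring,
      ← Complex.ofReal_exp]
    exact Complex.ofReal_re _
  have hvol (x : EuclideanSpace ℝ (Fin d)) : volume.real (Metric.ball x q) =
      q ^ d * (√π ^ d / Real.Gamma ((d : ℝ) / 2 + 1)) := by
    rw [measureReal_def, EuclideanSpace.volume_ball, ENNReal.toReal_mul, ENNReal.toReal_pow,
      ENNReal.toReal_ofReal hq.le, Fintype.card_fin, ENNReal.toReal_ofReal (by positivity)]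
  have hterm (k : ι) : q ^ d * (√π ^ d / Real.Gamma ((d : ℝ) / 2 + 1)) *
      exp (-(2 * t) * ‖y k‖ ^ 2) ≤
      ∫ z in Metric.ball (y k) q, exp (2 * t * q ^ 2) * exp (-t * ‖z‖ ^ 2) := by
    rw [← hvol (y k), ← smul_eq_mul, ← setIntegral_const]
    refine setIntegral_mono_on (integrableOn_const measure_ball_lt_top.ne)
      (hint.const_mul _).integrableOn measurableSet_ball fun z hz => ?_
    rw [← exp_add, exp_le_exp]
    have h1 : ‖z‖ ≤ ‖y k‖ + q := by
      have := norm_add_le (y k) (z - y k)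
      rw [add_sub_cancel] at this
      rw [mem_ball_iff_norm] at hz
      linarith
    have h2 : ‖z‖ ^ 2 ≤ 2 * ‖y k‖ ^ 2 + 2 * q ^ 2 := by
      have : ‖z‖ ^ 2 ≤ (‖y k‖ + q) ^ 2 := by gcongr
      nlinarith [sq_nonneg (‖y k‖ - q)]
    nlinarith
  have hdisj : Set.Pairwise (s : Set ι) (Function.onFun Disjoint fun k => Metric.ball (y k) q) :=
    fun i hi j hj hij => Metric.ball_disjoint_ball (by linarith [hy i hi j hj hij])
  have hsum : q ^ d * (√π ^ d / Real.Gamma ((d : ℝ) / 2 + 1)) *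
      ∑ k ∈ s, exp (-(2 * t) * ‖y k‖ ^ 2) ≤ exp (2 * t * q ^ 2) * (√π / √t) ^ d := by
    calc _ ≤ ∑ k ∈ s, ∫ z in Metric.ball (y k) q, exp (2 * t * q ^ 2) * exp (-t * ‖z‖ ^ 2) := by
          rw [Finset.mul_sum]; exact Finset.sum_le_sum fun k _ => hterm k
      _ = ∫ z in ⋃ k ∈ s, Metric.ball (y k) q, exp (2 * t * q ^ 2) * exp (-t * ‖z‖ ^ 2) :=
          (integral_biUnion_finset s (fun _ _ => measurableSet_ball) hdisj
            fun _ _ => (hint.const_mul _).integrableOn).symm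
      _ ≤ ∫ z : EuclideanSpace ℝ (Fin d), exp (2 * t * q ^ 2) * exp (-t * ‖z‖ ^ 2) :=
          setIntegral_le_integral (hint.const_mul _) (ae_of_all _ fun z => by positivity)
      _ = _ := by
          rw [integral_const_mul, GaussianFourier.integral_rexp_neg_mul_sq_norm ht,
            finrank_euclideanSpace_fin, ← Real.sqrt_div pi_pos.le,
            Real.sqrt_eq_rpow, ← Real.rpow_mul_natCast (by positivity)]
          congr 2; ring
  rw [← le_div_iff₀' (by positivity)] at hsum
  refine hsum.trans_eq ?_
  rw [mul_pow, div_pow]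
  field_simp

section CosineTransform

variable {d : ℕ}

theorem integrable_mul_cos {f : (Fin d → ℝ) → ℝ} (hf : Integrable f) (x : Fin d → ℝ) :
    Integrable fun ω => f ω * cos (∑ i, ω i * x i) := by
  refine hf.mul_bdd (c := 1) (Continuous.aestronglyMeasurable (by fun_prop)) (ae_of_all _ fun ω => ?_)
  rw [Real.norm_eq_abs]
  exact abs_cos_le_one _

theorem integrable_exp_neg_mul_sum_sq {b : ℝ} (hb : 0 < b) :
    Integrable fun ω : Fin d → ℝ => exp (-b * ∑ i, ω i ^ 2) := by
  have h := (GaussianFourier.integrable_cexp_neg_mul_sum_add (b := (b : ℂ)) (by simpa using hb)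
    (fun _ : Fin d => 0)).re
  refine h.congr (ae_of_all _ fun z => ?_)
  simp only [zero_mul, Finset.sum_const_zero, add_zero]
  rw [show (-(b : ℂ) * ∑ i, (z i : ℂ) ^ 2) = ((-b * ∑ i, z i ^ 2 : ℝ) : ℂ) by push_cast; ring,
    ← Complex.ofReal_exp]
  exact Complex.ofReal_re _

theorem integral_exp_neg_mul_sum_sq_mul_cos {b : ℝ} (hb : 0 < b) (x : Fin d → ℝ) :
    ∫ ω : Fin d → ℝ, exp (-b * ∑ i, ω i ^ 2) * cos (∑ i, ω i * x i) =
      √(π / b) ^ d * exp (-(∑ i, x i ^ 2) / (4 * b)) := by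
  have hb' : 0 < (b : ℂ).re := by simpa using hb
  have h := GaussianFourier.integral_cexp_neg_mul_sum_add hb' (fun i => Complex.I * (x i : ℂ))
  have hi := GaussianFourier.integrable_cexp_neg_mul_sum_add hb' (fun i => Complex.I * (x i : ℂ))
  have hre := congrArg Complex.re h
  rw [← RCLike.re_eq_complex_re, ← integral_re hi] at hre
  convert hre using 1
  · congr 1
    ext ω
    rw [show (-(b : ℂ) * ∑ i, (ω i : ℂ) ^ 2 + ∑ i, Complex.I * (x i : ℂ) * (ω i : ℂ)) =
      ((-b * ∑ i, ω i ^ 2 : ℝ) : ℂ) + ((∑ i, ω i * x i : ℝ) : ℂ) * Complex.I by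
        push_cast; rw [Finset.sum_mul]; congr 1; exact Finset.sum_congr rfl fun i _ => by ring]
    rw [RCLike.re_eq_complex_re, Complex.exp_re]
    simp only [Complex.add_re, Complex.add_im, Complex.ofReal_re, Complex.ofReal_im,
      Complex.mul_re, Complex.mul_im, Complex.I_re, Complex.I_im]
    norm_num
  · rw [RCLike.re_eq_complex_re,
      show ((π : ℂ) / b) ^ ((Fintype.card (Fin d) : ℂ) / 2) = ((√(π / b) ^ d : ℝ) : ℂ) by
        rw [Real.sqrt_eq_rpow, ← Real.rpow_mul_natCast (by positivity),
          Complex.ofReal_cpow (by positivity)]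
        push_cast
        rw [Fintype.card_fin]
        congr 1; ring,
      show (∑ i, (Complex.I * (x i : ℂ)) ^ 2) / (4 * (b : ℂ)) =
        ((-(∑ i, x i ^ 2) / (4 * b) : ℝ) : ℂ) by
        push_cast
        simp only [mul_pow, Complex.I_sq, ← Finset.mul_sum]
        ring,
      ← Complex.ofReal_exp, ← Complex.ofReal_mul, Complex.ofReal_re]

theorem sum_sum_mul_integral_cos_mono {ι : Type*} [Fintype ι] {f g : (Fin d → ℝ) → ℝ}
    (hf : Integrable f) (hg : Integrable g) (hfg : ∀ ω, f ω ≤ g ω)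
    (Y : ι → Fin d → ℝ) (a : ι → ℝ) :
    ∑ i, ∑ j, a i * a j * ∫ ω, f ω * cos (∑ l, ω l * (Y i - Y j) l) ≤
      ∑ i, ∑ j, a i * a j * ∫ ω, g ω * cos (∑ l, ω l * (Y i - Y j) l) := by
  have hpush {k : (Fin d → ℝ) → ℝ} (hk : Integrable k) :
      ∑ i, ∑ j, a i * a j * ∫ ω, k ω * cos (∑ l, ω l * (Y i - Y j) l) =
        ∫ ω, ∑ i, ∑ j, a i * a j * (k ω * cos (∑ l, ω l * (Y i - Y j) l)) := by
    rw [integral_finsetSum _ fun i _ => integrable_finsetSum _ fun j _ =>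
      (integrable_mul_cos hk _).const_mul _]
    refine Finset.sum_congr rfl fun i _ => ?_
    rw [integral_finsetSum _ fun j _ => (integrable_mul_cos hk _).const_mul _]
    exact Finset.sum_congr rfl fun j _ => (integral_const_mul _ _).symm
  have hint {k : (Fin d → ℝ) → ℝ} (hk : Integrable k) :
      Integrable fun ω => ∑ i, ∑ j, a i * a j * (k ω * cos (∑ l, ω l * (Y i - Y j) l)) :=
    integrable_finsetSum _ fun i _ => integrable_finsetSum _ fun j _ =>
      (integrable_mul_cos hk _).const_mul _
  have hsq (k : (Fin d → ℝ) → ℝ) (ω : Fin d → ℝ) :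
      ∑ i, ∑ j, a i * a j * (k ω * cos (∑ l, ω l * (Y i - Y j) l)) =
        k ω * ((∑ i, a i * cos (∑ l, ω l * Y i l)) ^ 2 +
          (∑ i, a i * sin (∑ l, ω l * Y i l)) ^ 2) := by
    rw [pow_two, pow_two, Finset.sum_mul_sum, Finset.sum_mul_sum, ← Finset.sum_add_distrib,
      Finset.mul_sum]
    refine Finset.sum_congr rfl fun i _ => ?_
    rw [← Finset.sum_add_distrib, Finset.mul_sum]
    refine Finset.sum_congr rfl fun j _ => ?_
    simp only [Pi.sub_apply, mul_sub, Finset.sum_sub_distrib, cos_sub]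
    ring
  rw [hpush hf, hpush hg]
  refine integral_mono (hint hf) (hint hg) fun ω => ?_
  simp only [hsq]
  exact mul_le_mul_of_nonneg_right (hfg ω) (by positivity)

end CosineTransform

theorem diag_sub_offDiag_le_quadForm {ι : Type*} [Fintype ι] [DecidableEq ι] {B : ι → ι → ℝ}
    {D S : ℝ} (hsymm : ∀ i j, B i j = B j i) (hdiag : ∀ i, B i i = D)
    (hnonneg : ∀ i j, i ≠ j → 0 ≤ B i j)
    (hrow : ∀ i, ∑ j ∈ Finset.univ.erase i, B i j ≤ S) (a : ι → ℝ) :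
    (D - S) * ∑ i, a i ^ 2 ≤ ∑ i, ∑ j, a i * a j * B i j := by
  set E : ι → ι → ℝ := fun i j => if i = j then 0 else B i j with hE
  have hE0 i j : 0 ≤ E i j := by
    simp only [hE]; split_ifs with h
    · exact le_rfl
    · exact hnonneg i j h
  have hEs i j : E i j = E j i := by simp only [hE, hsymm i j, eq_comm]
  have hErow i : ∑ j, E i j ≤ S := by
    refine le_of_eq_of_le ?_ (hrow i)
    rw [← Finset.add_sum_erase _ _ (Finset.mem_univ i)]
    simp only [hE, if_true, zero_add]
    exact Finset.sum_congr rfl fun j hj => if_neg (Finset.ne_of_mem_erase hj).symm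
  have hterm i j : a i * a j * B i j ≥
      (if i = j then D * a i ^ 2 else 0) - (a i ^ 2 / 2 * E i j + a j ^ 2 / 2 * E j i) := by
    by_cases h : i = j
    · subst h; simp only [hE, if_true, hdiag]; nlinarith
    · have := hE0 i j
      rw [← hEs i j]
      simp only [hE, if_neg h] at this ⊢
      nlinarith [mul_nonneg this (sq_nonneg (a i + a j))]
  have hswap : ∑ i, ∑ j, a j ^ 2 / 2 * E j i = ∑ i, ∑ j, a i ^ 2 / 2 * E i j :=
    Finset.sum_comm
  calc (D - S) * ∑ i, a i ^ 2 = ∑ i, (D * a i ^ 2 - a i ^ 2 * S) := by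
        rw [Finset.mul_sum]; exact Finset.sum_congr rfl fun i _ => by ring
    _ ≤ ∑ i, (D * a i ^ 2 - a i ^ 2 * ∑ j, E i j) := by
        gcongr with i; exact hErow i
    _ = ∑ i, ∑ j, ((if i = j then D * a i ^ 2 else 0) -
          (a i ^ 2 / 2 * E i j + a j ^ 2 / 2 * E j i)) := by
        simp only [Finset.sum_sub_distrib, Finset.sum_add_distrib, hswap, Finset.sum_ite_eq,
          Finset.mem_univ, if_true, ← Finset.mul_sum]
        rw [← Finset.sum_add_distrib]
        congr 1
        exact Finset.sum_congr rfl fun i _ => by ring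
    _ ≤ _ := Finset.sum_le_sum fun i _ => Finset.sum_le_sum fun j _ => hterm i j

section Separation

variable {d n : ℕ}

theorem euclNorm_eq_norm (v : Fin d → ℝ) : euclNorm v = ‖WithLp.toLp 2 v‖ := by
  simp [euclNorm, EuclideanSpace.norm_eq]

theorem euclNorm_sq (v : Fin d → ℝ) : euclNorm v ^ 2 = ∑ i, v i ^ 2 :=
  Real.sq_sqrt (Finset.sum_nonneg fun _ _ => sq_nonneg _)

theorem two_mul_sepj_le (Y : Fin n → Fin d → ℝ) {j k : Fin n} (h : k ≠ j) :
    2 * sepj Y j ≤ euclNorm (Y j - Y k) := by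
  have : sInf {r : ℝ | ∃ k, k ≠ j ∧ r = euclNorm (Y j - Y k)} ≤ euclNorm (Y j - Y k) :=
    csInf_le ⟨0, by rintro _ ⟨k, -, rfl⟩; exact Real.sqrt_nonneg _⟩ ⟨k, h, rfl⟩
  rw [sepj]; linarith

theorem sepj_pos (hn : 2 ≤ n) {Y : Fin n → Fin d → ℝ} (hY : Function.Injective Y) (j : Fin n) :
    0 < sepj Y j := by
  have : Nontrivial (Fin n) := Fin.nontrivial_iff_two_le.mpr hn
  have hfin : {r : ℝ | ∃ k, k ≠ j ∧ r = euclNorm (Y j - Y k)}.Finite :=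
    (Set.finite_range fun k => euclNorm (Y j - Y k)).subset
      (by rintro _ ⟨k, -, rfl⟩; exact ⟨k, rfl⟩)
  obtain ⟨k₀, hk₀⟩ := exists_ne j
  have hne : {r : ℝ | ∃ k, k ≠ j ∧ r = euclNorm (Y j - Y k)}.Nonempty := ⟨_, k₀, hk₀, rfl⟩
  obtain ⟨k, hk, h⟩ := hne.csInf_mem hfin
  rw [sepj, h, euclNorm_eq_norm]
  have : WithLp.toLp 2 (Y j - Y k) ≠ 0 := by
    simpa [sub_eq_zero] using fun e => hk (hY e).symm
  have := norm_pos_iff.mpr this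
  positivity

theorem exists_sepj_eq_sep (hn : 2 ≤ n) (Y : Fin n → Fin d → ℝ) : ∃ i, sepj Y i = sep Y :=
  have : Nonempty (Fin n) := ⟨⟨0, by omega⟩⟩
  exists_eq_ciInf_of_finite

theorem two_mul_sep_le (Y : Fin n → Fin d → ℝ) {j k : Fin n} (h : k ≠ j) :
    2 * sep Y ≤ euclNorm (Y j - Y k) :=
  le_trans (by gcongr; exact ciInf_le (Set.finite_range _).bddBelow j) (two_mul_sepj_le Y h)

end Separation

/-- A difference of Gaussians that is at most `1` everywhere and nonpositive outside the ball of
radius `2 * M`. -/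
noncomputable def gaussianBump (d : ℕ) (M : ℝ) (ω : Fin d → ℝ) : ℝ :=
  exp (-(d / (2 * M ^ 2)) * ∑ i, ω i ^ 2) -
    exp (-(d : ℝ)) * exp (-(d / (4 * M ^ 2)) * ∑ i, ω i ^ 2)

section GaussianBump

variable {d : ℕ} {M : ℝ}

theorem integrable_gaussianBump (hd : 1 ≤ d) (hM : 0 < M) : Integrable (gaussianBump d M) := by
  have hd' : (0 : ℝ) < d := by exact_mod_cast hd
  exact (integrable_exp_neg_mul_sum_sq (by positivity)).sub
    ((integrable_exp_neg_mul_sum_sq (by positivity)).const_mul _)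

theorem gaussianBump_le_one (ω : Fin d → ℝ) : gaussianBump d M ω ≤ 1 := by
  have hs : 0 ≤ ∑ i, ω i ^ 2 := Finset.sum_nonneg fun _ _ => sq_nonneg _
  have h : exp (-(d / (2 * M ^ 2)) * ∑ i, ω i ^ 2) ≤ 1 := by
    rw [exp_le_one_iff, neg_mul]
    exact neg_nonpos.mpr (by positivity)
  have : 0 ≤ exp (-(d : ℝ)) * exp (-(d / (4 * M ^ 2)) * ∑ i, ω i ^ 2) := by positivity
  rw [gaussianBump]; linarith

theorem gaussianBump_nonpos (hM : 0 < M) {ω : Fin d → ℝ} (hω : 2 * M ≤ euclNorm ω) :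
    gaussianBump d M ω ≤ 0 := by
  rw [gaussianBump, sub_nonpos, ← exp_add, exp_le_exp, ← euclNorm_sq]
  have h : (2 * M) ^ 2 ≤ euclNorm ω ^ 2 := by gcongr
  have h2 : (d : ℝ) ≤ d / (4 * M ^ 2) * euclNorm ω ^ 2 := by
    rw [div_mul_eq_mul_div, le_div_iff₀ (by positivity)]
    exact mul_le_mul_of_nonneg_left (by linarith) (by positivity)
  have h3 : (d : ℝ) / (2 * M ^ 2) = 2 * (d / (4 * M ^ 2)) := by field_simp; norm_num
  rw [h3]; linarith

theorem fourierInf_nonneg {Φhat : (Fin d → ℝ) → ℝ} (hΦ : ∀ ω, 0 ≤ Φhat ω) (M : ℝ) :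
    0 ≤ fourierInf Φhat M :=
  Real.sInf_nonneg (by rintro _ ⟨ω, -, rfl⟩; exact hΦ ω)

theorem fourierInf_mul_gaussianBump_le (hM : 0 < M) {Φhat : (Fin d → ℝ) → ℝ}
    (hΦ : ∀ ω, 0 ≤ Φhat ω) (ω : Fin d → ℝ) :
    fourierInf Φhat M * gaussianBump d M ω ≤ Φhat ω := by
  have h0 := fourierInf_nonneg hΦ M
  rcases le_total (euclNorm ω) (2 * M) with h | h
  · have : fourierInf Φhat M ≤ Φhat ω :=
      csInf_le ⟨0, by rintro _ ⟨ω, -, rfl⟩; exact hΦ ω⟩ ⟨ω, h, rfl⟩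
    exact (mul_le_of_le_one_right h0 (gaussianBump_le_one ω)).trans this
  · exact (mul_nonpos_of_nonneg_of_nonpos h0 (gaussianBump_nonpos hM h)).trans (hΦ ω)

theorem integral_gaussianBump_mul_cos (hd : 1 ≤ d) (hM : 0 < M) (x : Fin d → ℝ) :
    ∫ ω, gaussianBump d M ω * cos (∑ i, ω i * x i) =
      √(2 * π) ^ d * (M / √d) ^ d * (exp (-((M / √d) ^ 2 / 2) * euclNorm x ^ 2) -
        √2 ^ d * exp (-(d : ℝ)) * exp (-(M / √d) ^ 2 * euclNorm x ^ 2)) := by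
  have hd' : (0 : ℝ) < d := by exact_mod_cast hd
  have hα : 0 < (d : ℝ) / (2 * M ^ 2) := by positivity
  have hβ : 0 < (d : ℝ) / (4 * M ^ 2) := by positivity
  have h1 : √(π / ((d : ℝ) / (2 * M ^ 2))) = √(2 * π) * (M / √d) := by
    rw [show π / ((d : ℝ) / (2 * M ^ 2)) = (2 * π) * (M ^ 2 / d) by field_simp,
      Real.sqrt_mul (by positivity), Real.sqrt_div (by positivity), Real.sqrt_sq hM.le]
  have h2 : √(π / ((d : ℝ) / (4 * M ^ 2))) = √2 * (√(2 * π) * (M / √d)) := by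
    rw [← h1, ← Real.sqrt_mul (by norm_num)]
    congr 1; field_simp; norm_num
  simp only [gaussianBump, sub_mul, mul_assoc (exp (-(d : ℝ)))]
  rw [integral_sub (integrable_mul_cos (integrable_exp_neg_mul_sum_sq hα) x)
      ((integrable_mul_cos (integrable_exp_neg_mul_sum_sq hβ) x).const_mul _),
    integral_const_mul, integral_exp_neg_mul_sum_sq_mul_cos hα,
    integral_exp_neg_mul_sum_sq_mul_cos hβ, h1, h2, euclNorm_sq,
    div_pow M (√d) 2, Real.sq_sqrt hd'.le]
  have e1 : -(∑ i, x i ^ 2) / (4 * (d / (2 * M ^ 2))) = -(M ^ 2 / d / 2) * ∑ i, x i ^ 2 := by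
    field_simp; norm_num
  have e2 : -(∑ i, x i ^ 2) / (4 * (d / (4 * M ^ 2))) = -(M ^ 2 / d) * ∑ i, x i ^ 2 := by
    field_simp
  rw [e1, e2, mul_pow, mul_pow, mul_pow]
  ring

end GaussianBump

theorem fourierInf_mul_le_quadForm {d n : ℕ} (hd : 1 ≤ d) {Φhat : (Fin d → ℝ) → ℝ}
    (hnonneg : ∀ ω, 0 ≤ Φhat ω) (hint : Integrable Φhat) (Y : Fin n → Fin d → ℝ)
    {q c : ℝ} (hq : 0 < q) (hsep : ∀ j k, k ≠ j → 2 * q ≤ euclNorm (Y j - Y k)) (hc : 0 < c)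
    (h : Real.Gamma ((d : ℝ) / 2 + 1) ^ 2 * π / 18 * (12 / c) ^ (d + 1) < 1)
    (a : Fin n → ℝ) (ha : ∑ i, a i ^ 2 = 1) :
    √(2 * π) ^ d * Upsilon0 Φhat (c / q) ≤
      ∑ i, ∑ j, a i * a j * ∫ ω, Φhat ω * cos (∑ l, ω l * (Y i - Y j) l) := by
  have hd' : (0 : ℝ) < d := by exact_mod_cast hd
  have hΓ : 0 < Real.Gamma ((d : ℝ) / 2 + 1) := Real.Gamma_pos_of_pos (by positivity)
  set M := c / q with hMdef
  have hM : 0 < M := by positivity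
  set m := fourierInf Φhat M
  have hm : 0 ≤ m := fourierInf_nonneg hnonneg M
  set s := M / √d with hs
  have hs0 : 0 < s := by positivity
  have hsq : s * q = c / √d := by rw [hs, hMdef]; field_simp
  set ε := √2 ^ d * exp (-(d : ℝ))
  have hε1 : ε ≤ 521 / 1000 := sqrt_two_div_exp_pow_le hd
  have hε0 : 0 ≤ ε := by positivity
  set T := Real.Gamma ((d : ℝ) / 2 + 1) * (√8 / (c / √d)) ^ d * exp (-(3 / 4 * (c / √d) ^ 2))
  have hT : T ≤ 1 / 25 := packing_tail_le hd hc h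
  set B : Fin n → Fin n → ℝ := fun i j => exp (-(s ^ 2 / 2) * euclNorm (Y i - Y j) ^ 2) -
    ε * exp (-s ^ 2 * euclNorm (Y i - Y j) ^ 2) with hB
  have hBint i j : ∫ ω, gaussianBump d M ω * cos (∑ l, ω l * (Y i - Y j) l) =
      √(2 * π) ^ d * s ^ d * B i j := integral_gaussianBump_mul_cos hd hM _
  have hquad : (1 - ε - T) * ∑ i, a i ^ 2 ≤ ∑ i, ∑ j, a i * a j * B i j := by
    refine diag_sub_offDiag_le_quadForm (fun i j => ?_) (fun i => ?_) (fun i j _ => ?_)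
      (fun i => ?_) a
    · simp only [hB, euclNorm_sq, Pi.sub_apply, sub_sq_comm (Y i _)]
    · simp [hB, euclNorm]
    · have h1 : exp (-s ^ 2 * euclNorm (Y i - Y j) ^ 2) ≤
          exp (-(s ^ 2 / 2) * euclNorm (Y i - Y j) ^ 2) := by
        rw [exp_le_exp]; nlinarith [sq_nonneg (s * euclNorm (Y i - Y j))]
      have h2 := exp_pos (-s ^ 2 * euclNorm (Y i - Y j) ^ 2)
      simp only [hB]
      nlinarith
    · set t := s ^ 2 / 8 with ht
      have hterm j (hj : j ∈ Finset.univ.erase i) : B i j ≤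
          exp (-(s * q) ^ 2) * exp (-(2 * t) * ‖WithLp.toLp 2 (Y i - Y j)‖ ^ 2) := by
        have h1 := hsep i j (Finset.ne_of_mem_erase hj)
        have h2 : (2 * q) ^ 2 ≤ euclNorm (Y i - Y j) ^ 2 := by gcongr
        have h3 : exp (-(s ^ 2 / 2) * euclNorm (Y i - Y j) ^ 2) ≤
            exp (-(s * q) ^ 2) * exp (-(2 * t) * ‖WithLp.toLp 2 (Y i - Y j)‖ ^ 2) := by
          rw [← euclNorm_eq_norm, ← exp_add, exp_le_exp]
          nlinarith [mul_le_mul_of_nonneg_left h2 (sq_nonneg s)]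
        have h4 : 0 ≤ ε * exp (-s ^ 2 * euclNorm (Y i - Y j) ^ 2) := by positivity
        simp only [hB]
        linarith
      have hpack := sum_exp_neg_mul_sq_norm_le hd (Finset.univ.erase i)
        (fun j => WithLp.toLp 2 (Y i - Y j)) hq (t := t) (by positivity) (fun j _ k _ hjk => by
          rw [dist_eq_norm, ← WithLp.toLp_sub, ← euclNorm_eq_norm, sub_sub_sub_cancel_left]
          exact hsep k j hjk)
      have ht' : √t * q = c / √d / √8 := by
        rw [ht, Real.sqrt_div (by positivity), Real.sqrt_sq hs0.le, ← hsq]; ring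
      calc _ ≤ ∑ j ∈ Finset.univ.erase i,
            exp (-(s * q) ^ 2) * exp (-(2 * t) * ‖WithLp.toLp 2 (Y i - Y j)‖ ^ 2) :=
            Finset.sum_le_sum hterm
        _ ≤ exp (-(s * q) ^ 2) *
            (exp (2 * t * q ^ 2) * (Real.Gamma ((d : ℝ) / 2 + 1) / (√t * q) ^ d)) := by
            rw [← Finset.mul_sum]; gcongr
        _ = T := by
            rw [← mul_assoc, ← exp_add, ht', ht,
              show -(s * q) ^ 2 + 2 * (s ^ 2 / 8) * q ^ 2 = -(3 / 4 * (s * q) ^ 2) by ring, hsq,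
              div_eq_mul_inv (Real.Gamma _), ← inv_pow, inv_div]
            ring
  have hmono := sum_sum_mul_integral_cos_mono ((integrable_gaussianBump hd hM).const_mul m) hint
    (fourierInf_mul_gaussianBump_le hM hnonneg) Y a
  refine le_trans ?_ hmono
  have hΥ : Upsilon0 Φhat M ≤ m * s ^ d * (413 / 1000) := by
    have h8 : (2 : ℝ) ^ ((3 : ℝ) / 2) = √8 := by
      rw [show (8 : ℝ) = 2 ^ (3 : ℝ) by norm_num, Real.sqrt_eq_rpow, ← Real.rpow_mul (by norm_num)]
      norm_num
    have hM8 : M / √8 = s * √((d : ℝ) / 8) := by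
      rw [hs, Real.sqrt_div (by positivity)]; field_simp
    calc Upsilon0 Φhat M = m * s ^ d * (√((d : ℝ) / 8) ^ d / Real.Gamma ((d : ℝ) / 2 + 1)) := by
          rw [Upsilon0, h8, hM8, mul_pow]; ring
      _ ≤ _ := mul_le_mul_of_nonneg_left (volume_ratio_le hd) (by positivity)
  calc √(2 * π) ^ d * Upsilon0 Φhat M ≤ √(2 * π) ^ d * (m * s ^ d * (1 - ε - T)) := by
        gcongr
        exact hΥ.trans (by gcongr; linarith)
    _ ≤ √(2 * π) ^ d * (m * s ^ d * ∑ i, ∑ j, a i * a j * B i j) := by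
        gcongr
        simpa [ha] using hquad
    _ = _ := by
        simp only [mul_assoc m, integral_const_mul, hBint, Finset.mul_sum]
        exact Finset.sum_congr rfl fun i _ => Finset.sum_congr rfl fun j _ => by ring

theorem eq_integral_mul_cos {d : ℕ} {Φ Φhat : (Fin d → ℝ) → ℝ} (hint : Integrable Φhat)
    (x : Fin d → ℝ)
    (hinv : (Φ x : ℂ) = (((2 * π) ^ (-(d : ℝ) / 2) : ℝ) : ℂ) *
      ∫ ω, (Φhat ω : ℂ) * Complex.exp (Complex.I * ((∑ i, ω i * x i : ℝ) : ℂ))) :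
    Φ x = (√(2 * π) ^ d)⁻¹ * ∫ ω, Φhat ω * cos (∑ i, ω i * x i) := by
  have hi : Integrable fun ω : Fin d → ℝ =>
      (Φhat ω : ℂ) * Complex.exp (Complex.I * ((∑ i, ω i * x i : ℝ) : ℂ)) := by
    refine hint.ofReal.mul_bdd (c := 1) (Continuous.aestronglyMeasurable (by fun_prop))
      (ae_of_all _ fun ω => ?_)
    rw [mul_comm, Complex.norm_exp_ofReal_mul_I]
  have hre := congrArg Complex.re hinv
  rw [Complex.ofReal_re, Complex.re_ofReal_mul, ← RCLike.re_eq_complex_re, ← integral_re hi] at hre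
  rw [hre]
  congr 1
  · rw [Real.sqrt_eq_rpow, ← Real.rpow_mul_natCast (by positivity),
      ← Real.rpow_neg (by positivity)]
    congr 1; ring
  · congr 1
    ext ω
    rw [RCLike.re_eq_complex_re, Complex.re_ofReal_mul, mul_comm Complex.I,
      Complex.exp_ofReal_mul_I_re]

/-- Case 1 (stationary) numeric error bound: for the kernel `Ψ(u,v) = σ²Φ(Θ(u−v))` with
`Φ` continuous, integrable, even, with nonnegative integrable Fourier transform, and
design points with separation distances `q_j(Θ)`, `q(Θ)` of the transformed points, the
smallest eigenvalue of the kernel matrix satisfies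
`λ_min(Ψ(X,X)) ≥ σ²·minᵢ ℓ_i(Θ)`. -/
theorem stationary_lamMin_lower_bound {d n : ℕ} (hd : 1 ≤ d) (hn : 2 ≤ n)
    (Ω : Set (Fin d → ℝ))
    (Θ : Matrix (Fin d) (Fin d) ℝ) (hΘ : IsUnit Θ.det)
    (σ2 : ℝ) (hσ2 : 0 < σ2)
    (Φ : (Fin d → ℝ) → ℝ) (Φhat : (Fin d → ℝ) → ℝ)
    (hΦcont : Continuous Φ) (hΦint : Integrable Φ)
    (hΦeven : ∀ x, Φ (-x) = Φ x)
    (hΦhat_def : ∀ ω, (Φhat ω : ℂ) =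
      (((2 * π) ^ (-(d : ℝ) / 2) : ℝ) : ℂ) *
        ∫ x, (Φ x : ℂ) * Complex.exp (-(Complex.I * ((∑ i, ω i * x i : ℝ) : ℂ))))
    (hΦhat_nonneg : ∀ ω, 0 ≤ Φhat ω)
    (hΦhat_int : Integrable Φhat)
    (hΦinv : ∀ x, (Φ x : ℂ) =
      (((2 * π) ^ (-(d : ℝ) / 2) : ℝ) : ℂ) *
        ∫ ω, (Φhat ω : ℂ) * Complex.exp (Complex.I * ((∑ i, ω i * x i : ℝ) : ℂ)))
    (X : Fin n → (Fin d → ℝ)) (hXΩ : ∀ i, X i ∈ Ω)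
    (hinj : Function.Injective fun i => Θ *ᵥ X i)
    (c : ℝ) (hc : 0 < c) :
    lamMin (Matrix.of fun i j => σ2 * Φ (Θ *ᵥ (X i - X j))) ≥
      σ2 * ⨅ i,
        Upsilon0 Φhat (c / sep fun k => Θ *ᵥ X k) *
          (1 - Real.Gamma ((d : ℝ) / 2 + 1) ^ 2 * π / 18 *
              ((sep fun k => Θ *ᵥ X k) / sepj (fun k => Θ *ᵥ X k) i) *
              (12 / c) ^ (d + 1)) := by
  set Y : Fin n → Fin d → ℝ := fun k => Θ *ᵥ X k with hY
  have : Nonempty (Fin n) := ⟨⟨0, by omega⟩⟩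
  obtain ⟨i₀, hi₀⟩ := exists_sepj_eq_sep hn Y
  have hq : 0 < sep Y := hi₀ ▸ sepj_pos hn hinj i₀
  set K := Real.Gamma ((d : ℝ) / 2 + 1) ^ 2 * π / 18 * (12 / c) ^ (d + 1) with hK
  have hK0 : 0 ≤ K := by positivity
  have hΓ : 0 < Real.Gamma ((d : ℝ) / 2 + 1) := Real.Gamma_pos_of_pos (by positivity)
  have hΥ : 0 ≤ Upsilon0 Φhat (c / sep Y) := by
    have := fourierInf_nonneg hΦhat_nonneg (c / sep Y)
    rw [Upsilon0]; positivity
  have hinf := ciInf_le (Set.finite_range fun i => Upsilon0 Φhat (c / sep Y) *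
    (1 - Real.Gamma ((d : ℝ) / 2 + 1) ^ 2 * π / 18 * (sep Y / sepj Y i) *
      (12 / c) ^ (d + 1))).bddBelow i₀
  simp only [hi₀, div_self hq.ne', mul_one, ← hK] at hinf
  refine le_csInf ?_ ?_
  · exact ⟨_, Pi.single i₀ 1, by simp [Pi.single_apply], rfl⟩
  rintro _ ⟨a, ha, rfl⟩
  have hform : a ⬝ᵥ ((Matrix.of fun i j => σ2 * Φ (Θ *ᵥ (X i - X j))) *ᵥ a) =
      σ2 * ((√(2 * π) ^ d)⁻¹ *
        ∑ i, ∑ j, a i * a j * ∫ ω, Φhat ω * cos (∑ l, ω l * (Y i - Y j) l)) := by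
    simp only [dotProduct, Matrix.mulVec, Matrix.of_apply, Finset.mul_sum]
    refine Finset.sum_congr rfl fun i _ => Finset.sum_congr rfl fun j _ => ?_
    have hsub : Θ *ᵥ (X i - X j) = Y i - Y j := Matrix.mulVec_sub Θ _ _
    rw [hsub, eq_integral_mul_cos hΦhat_int _ (hΦinv _)]
    ring
  rw [hform]
  gcongr
  refine hinf.trans ?_
  rw [le_inv_mul_iff₀ (by positivity)]
  rcases lt_or_ge K 1 with h | h
  · refine le_trans ?_ (fourierInf_mul_le_quadForm hd hΦhat_nonneg hΦhat_int Y hq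
      (fun j k hjk => two_mul_sep_le Y hjk) hc h a ha)
    gcongr
    exact mul_le_of_le_one_right hΥ (by linarith)
  · have hpos := sum_sum_mul_integral_cos_mono (f := fun _ => 0)
      (integrable_zero _ _ _) hΦhat_int hΦhat_nonneg Y a
    simp only [zero_mul, integral_zero, mul_zero, Finset.sum_const_zero] at hpos
    exact (mul_nonpos_of_nonneg_of_nonpos (by positivity)
      (mul_nonpos_of_nonneg_of_nonpos hΥ (by linarith))).trans hpos
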